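/- Let R = ℤ[X]/⟨X² − X − 1⟩, let G be a group with a finite generating set A, let n ≥ 1, and let ρ : G → GL(n, R) be an injective group homomorphism. Then for every positive integer l there exists a maximal ideal I of R such that for every g ∈ G with g ≠ 1 that can be written as a product of at most l elements of A ∪ A⁻¹, the matrix obtained by applying the quotient map R → R/I entrywise to ρ(g) is not the identity matrix; that is, the composition of ρ with entrywise reduction modulo I is l-locally faithful. -/

import Mathlib

open Polynomial

theorem Int.isJacobsonRing : IsJacobsonRing ℤ := by
  rw [isJacobsonRing_iff_prime_eq]
  intro P hP
  by_cases h : P = ⊥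
  · subst h
    rw [eq_bot_iff]
    intro x hx
    rw [Ideal.mem_jacobson_bot] at hx
    rcases Int.isUnit_iff.mp (hx (3 * x)) with h | h
    · rw [Ideal.mem_bot]
      nlinarith
    · nlinarith [mul_self_nonneg x]
  · have := hP.isMaximal h
    exact Ideal.jacobson_eq_self_of_isMaximal

theorem irreducible_X_sq_sub_X_sub_one : Irreducible (X ^ 2 - X - 1 : ℤ[X]) := by
  have hd : (X ^ 2 - X - 1 : ℤ[X]).natDegree = 2 := by compute_degree!
  have hm : (X ^ 2 - X - 1 : ℤ[X]).Monic := by monicity!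
  rw [hm.irreducible_iff_roots_eq_zero_of_degree_le_three hd.ge (by omega)]
  refine Multiset.eq_zero_of_forall_notMem fun a ha => ?_
  have h : a ^ 2 - a - 1 = 0 := by simpa using (mem_roots'.mp ha).2
  have := Int.even_mul_pred_self a
  have h' : a * (a - 1) = 1 := by linarith
  rw [h'] at this
  exact absurd this (by decide)

theorem exists_isMaximal_forall_map_mk_ne_one {S ι : Type*} [CommRing S] [IsDomain S]
    [IsJacobsonRing S] [DecidableEq ι] {T : Set (Matrix ι ι S)} (hT : T.Finite)
    (h1 : ∀ M ∈ T, M ≠ 1) :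
    ∃ I : Ideal S, I.IsMaximal ∧ ∀ M ∈ T, M.map (Ideal.Quotient.mk I) ≠ 1 := by
  have hentry : ∀ M ∈ T, ∃ d : S, d ≠ 0 ∧ ∃ i j, d = M i j - (1 : Matrix ι ι S) i j := by
    intro M hM
    by_contra! hc
    refine h1 M hM (Matrix.ext fun i j => ?_)
    by_contra hij
    exact hc _ (sub_ne_zero.mpr hij) i j rfl
  choose! d hd0 hd using hentry
  have hprod : ∏ M ∈ hT.toFinset, d M ≠ 0 :=
    Finset.prod_ne_zero_iff.mpr fun M hM => hd0 M (hT.mem_toFinset.mp hM)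
  have hjac : (⊥ : Ideal S).jacobson = ⊥ :=
    IsJacobsonRing.out ‹_› Ideal.isPrime_bot.isRadical
  rw [ne_eq, ← Ideal.mem_bot, ← hjac, Ideal.jacobson, Ideal.mem_sInf] at hprod
  push Not at hprod
  obtain ⟨I, ⟨-, hI⟩, hmem⟩ := hprod
  refine ⟨I, hI, fun M hM h => hmem ?_⟩
  refine I.mem_of_dvd (Finset.dvd_prod_of_mem d (hT.mem_toFinset.mpr hM)) ?_
  obtain ⟨i, j, hij⟩ := hd M hM
  rw [hij, ← Ideal.Quotient.eq]
  have hMij := congrFun (congrFun h i) j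
  rw [Matrix.map_apply] at hMij
  rw [hMij]
  simp only [Matrix.one_apply]
  split_ifs <;> simp

theorem finite_prod_of_length_le {G : Type*} [Monoid G] {B : Set G} (hB : B.Finite) (l : ℕ) :
    {g : G | ∃ w : List G, w.length ≤ l ∧ (∀ x ∈ w, x ∈ B) ∧ w.prod = g}.Finite := by
  have := hB.to_subtype
  refine ((List.finite_length_le B l).image fun w => (w.map Subtype.val).prod).subset ?_
  rintro g ⟨w, hw, hwB, rfl⟩
  lift w to List B using hwB
  exact ⟨w, by simpa using hw, rfl⟩

/-- Given an injective representation ρ : G → GL(n, ℤ[φ]) of a group G with finite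
generating set A, for every l there is a maximal ideal I of ℤ[φ] = ℤ[X]/⟨X²−X−1⟩
such that entrywise reduction of ρ modulo I is l-locally faithful: no non-identity
element expressible as a product of at most l generators or inverse generators
is mapped to the identity matrix. -/
theorem stmt_13 (n : ℕ) (hn : 1 ≤ n) {G : Type*} [Group G] (A : Finset G)
    (hgen : Subgroup.closure (A : Set G) = ⊤)
    (ρ : G →* GL (Fin n) (ℤ[X] ⧸ Ideal.span {(X ^ 2 - X - 1 : ℤ[X])}))
    (hinj : Function.Injective ρ) (l : ℕ) (hl : 0 < l) :
    ∃ I : Ideal (ℤ[X] ⧸ Ideal.span {(X ^ 2 - X - 1 : ℤ[X])}), I.IsMaximal ∧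
      ∀ g : G, g ≠ 1 →
        (∃ w : List G, w.length ≤ l ∧ (∀ x ∈ w, x ∈ A ∨ x⁻¹ ∈ A) ∧ w.prod = g) →
        (ρ g : Matrix (Fin n) (Fin n)
            (ℤ[X] ⧸ Ideal.span {(X ^ 2 - X - 1 : ℤ[X])})).map
          (Ideal.Quotient.mk I) ≠ 1 := by
  have := Int.isJacobsonRing
  have hprime : (Ideal.span {(X ^ 2 - X - 1 : ℤ[X])}).IsPrime :=
    (Ideal.span_singleton_prime irreducible_X_sq_sub_X_sub_one.ne_zero).mpr
      irreducible_X_sq_sub_X_sub_one.prime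
  have hB : {x : G | x ∈ A ∨ x⁻¹ ∈ A}.Finite :=
    A.finite_toSet.union (A.finite_toSet.preimage inv_injective.injOn)
  have hT := ((finite_prod_of_length_le hB l).sdiff (t := {1})).image fun g =>
    (ρ g : Matrix (Fin n) (Fin n) (ℤ[X] ⧸ Ideal.span {(X ^ 2 - X - 1 : ℤ[X])}))
  obtain ⟨I, hI, h⟩ := exists_isMaximal_forall_map_mk_ne_one hT (by
    rintro _ ⟨g, ⟨-, hg⟩, rfl⟩ h
    refine hg (hinj ?_)
    rw [map_one]
    exact Units.ext h)
  exact ⟨I, hI, fun g hg hw => h _ ⟨g, ⟨hw, hg⟩, rfl⟩⟩
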